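/- Let Δ_γ, Δ_α, Δ_β be bounded closed intervals in ℝ with Δ_γ ∩ Δ_α = ∅ and Δ_β ∩ Δ_α = ∅, and let σ_γ ∈ M(Δ_γ), σ_α ∈ M(Δ_α), σ_β ∈ M(Δ_β). Let τ_{α,α} ∈ M(Δ_α) be the inverse measure of σ_α and τ_{α,β} ∈ M(Δ_α) the inverse measure of ⟨σ_α, σ_β⟩. Then for every f ∈ L¹(σ_γ) and every z ∈ ℂ ∖ Δ_α: (σ̂_α(z)/⟨σ_α,σ_β⟩^(z)) · ⟨⟨τ_{α,α}, σ_β, σ_α⟩, f·σ_γ, σ_α⟩^(z) = ⟨(⟨σ_β,σ_α⟩^/σ̂_β)·τ_{α,β}, f·σ_γ, σ_α, σ_β⟩^(z). Here f·σ_γ denotes the measure with density f with respect to σ_γ, and (⟨σ_β,σ_α⟩^/σ̂_β)·τ_{α,β} denotes the measure with density x ↦ ⟨σ_β,σ_α⟩^(x)/σ̂_β(x) with respect to τ_{α,β}. -/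

import Mathlib

open MeasureTheory Set Polynomial Filter

noncomputable section

/-- A signed Borel measure on `ℝ`, represented by a pair of (nonnegative) measures
(a "positive part" and a "negative part"). -/
structure SignedM where
  pos : MeasureTheory.Measure ℝ
  neg : MeasureTheory.Measure ℝ

namespace SignedM

/-- Integral of a complex-valued function against a signed measure. -/
def cintegral (s : SignedM) (f : ℝ → ℂ) : ℂ :=
  (∫ x, f x ∂s.pos) - ∫ x, f x ∂s.neg

/-- Integral of a real-valued function against a signed measure. -/
def rintegral (s : SignedM) (f : ℝ → ℝ) : ℝ :=
  (∫ x, f x ∂s.pos) - ∫ x, f x ∂s.neg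

/-- The Cauchy transform `ŝ(z) = ∫ ds(x)/(z - x)` at a complex point. -/
def cauchy (s : SignedM) (z : ℂ) : ℂ :=
  s.cintegral fun x => (z - (x : ℂ))⁻¹

/-- The Cauchy transform at a real point (real-valued). -/
def cauchyR (s : SignedM) (x : ℝ) : ℝ :=
  s.rintegral fun t => (x - t)⁻¹

/-- The total variation `|s|` (for the constant-sign representation used here). -/
def mass (s : SignedM) : ℝ :=
  (s.pos Set.univ).toReal + (s.neg Set.univ).toReal

/-- The (topological) support of a nonnegative measure. -/
def msupport (μ : MeasureTheory.Measure ℝ) : Set ℝ :=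
  {x | ∀ U : Set ℝ, IsOpen U → x ∈ U → μ U ≠ 0}

/-- The support of a signed measure. -/
def supp (s : SignedM) : Set ℝ := msupport s.pos ∪ msupport s.neg

/-- The signed measure `g·s` with (real, possibly sign-changing) density `g` w.r.t. `s`. -/
def withDensityR (s : SignedM) (g : ℝ → ℝ) : SignedM where
  pos := s.pos.withDensity (fun x => ENNReal.ofReal (g x)) +
    s.neg.withDensity (fun x => ENNReal.ofReal (-g x))
  neg := s.pos.withDensity (fun x => ENNReal.ofReal (-g x)) +
    s.neg.withDensity (fun x => ENNReal.ofReal (g x))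

/-- The product `⟨a, b⟩`: the measure with density `b̂` with respect to `a`. -/
def nik (a b : SignedM) : SignedM := a.withDensityR b.cauchyR

end SignedM

/-- `s ∈ M(Δ)`: a finite Borel measure with constant sign, whose support is compact and
consists of infinitely many points, `Δ` being the smallest closed interval containing it. -/
structure IsM (s : SignedM) (Δ : Set ℝ) : Prop where
  posFinite : MeasureTheory.IsFiniteMeasure s.pos
  negFinite : MeasureTheory.IsFiniteMeasure s.neg
  constSign : s.pos = 0 ∨ s.neg = 0
  compactSupp : IsCompact s.supp
  infiniteSupp : s.supp.Infinite
  hullEq : Δ = Set.Icc (sInf s.supp) (sSup s.supp)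

/-- A set of reals, viewed inside `ℂ`. -/
def cSet (Δ : Set ℝ) : Set ℂ := (fun x : ℝ => (x : ℂ)) '' Δ

/-- `τ` is the inverse measure of `s`: `1/ŝ(z) = z/|s| + b + τ̂(z)` on `ℂ ∖ Δ`. -/
def IsInverse (s τ : SignedM) (Δ : Set ℝ) : Prop :=
  ∃ b : ℝ, ∀ z : ℂ, z ∉ cSet Δ →
    (s.cauchy z)⁻¹ = z / (s.mass : ℂ) + (b : ℂ) + τ.cauchy z

/-- The iterated products `s_{j,k} = ⟨σ_j, σ_{j+1}, …, σ_k⟩` of a Nikishin system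
(`s_{j,k} = σ_j` when `j ≥ k`). -/
def nikSys (σ : ℕ → SignedM) : ℕ → ℕ → SignedM
  | j, k => if h : j < k then (σ j).nik (nikSys σ (j + 1) k) else σ j
  termination_by j k => k - j
  decreasing_by omega


/-- The Cauchy transform of the complex measure with density `w` with respect to `μ`. -/
def weightedCauchy (μ : Measure ℝ) (w : ℝ → ℂ) (z : ℂ) : ℂ :=
  ∫ x, w x * (z - (x : ℂ))⁻¹ ∂μ

/-- `w` is an integrable density for a measure `μ` concentrated on the compact set `K`. -/
structure IsWeightOn (μ : Measure ℝ) (w : ℝ → ℂ) (K : Set ℝ) : Prop where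
  compact : IsCompact K
  ae_mem : ∀ᵐ x ∂μ, x ∈ K
  integrable : Integrable w μ

lemma ofReal_mem_cSet {K : Set ℝ} {x : ℝ} : (x : ℂ) ∈ cSet K ↔ x ∈ K := by
  simp [cSet]

lemma isCompact_cSet {K : Set ℝ} (hK : IsCompact K) : IsCompact (cSet K) :=
  hK.image Complex.continuous_ofReal

lemma notMem_cSet_of_im_ne_zero {K : Set ℝ} {z : ℂ} (hz : z.im ≠ 0) : z ∉ cSet K := by
  rintro ⟨x, -, rfl⟩
  simp at hz

lemma notMem_cSet_of_disjoint {K L : Set ℝ} (h : Disjoint K L) {x : ℝ} (hx : x ∈ L) :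
    (x : ℂ) ∉ cSet K :=
  fun h' => h.ne_of_mem (ofReal_mem_cSet.1 h') hx rfl

lemma sub_ofReal_ne_zero {K : Set ℝ} {z : ℂ} (hz : z ∉ cSet K) {x : ℝ} (hx : x ∈ K) :
    z - (x : ℂ) ≠ 0 :=
  fun h => hz ⟨x, hx, (sub_eq_zero.1 h).symm⟩

lemma exists_le_norm_sub_ofReal {K : Set ℝ} (hK : IsCompact K) {z : ℂ} (hz : z ∉ cSet K) :
    ∃ δ > 0, ∀ w ∈ Metric.ball z δ, ∀ x ∈ K, δ ≤ ‖w - (x : ℂ)‖ := by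
  obtain ⟨ε, hε, h⟩ := Metric.isOpen_iff.1 (isCompact_cSet hK).isClosed.isOpen_compl z hz
  refine ⟨ε / 2, half_pos hε, fun w hw x hx => ?_⟩
  have h1 : ε ≤ dist (x : ℂ) z := by
    by_contra! hlt
    exact h (Metric.mem_ball.2 hlt) ⟨x, hx, rfl⟩
  have h2 := dist_triangle (x : ℂ) w z
  have h3 := Metric.mem_ball.1 hw
  rw [← dist_eq_norm, dist_comm]
  linarith

/-- Functions continuous off a real compact set are determined by their non-real values. -/
lemma eq_of_eq_nonreal {K : Set ℝ} {F G : ℂ → ℂ} (hF : ContinuousOn F (cSet K)ᶜ)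
    (hG : ContinuousOn G (cSet K)ᶜ) (h : ∀ z : ℂ, z.im ≠ 0 → F z = G z) {z : ℂ}
    (hz : z ∉ cSet K) : F z = G z := by
  have hsub : {z : ℂ | z.im ≠ 0} ⊆ (cSet K)ᶜ := fun z hz => notMem_cSet_of_im_ne_zero hz
  refine Set.EqOn.of_subset_closure (s := {z : ℂ | z.im ≠ 0}) (fun z hz => h z hz) hF hG hsub ?_ hz
  intro z _
  by_cases hz0 : z.im = 0
  · refine closure_mono (s := {z : ℂ | 0 < z.im}) (fun w hw => ne_of_gt hw) ?_
    rw [Complex.closure_setOfPred_lt_im]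
    exact hz0.ge
  · exact subset_closure hz0

namespace IsWeightOn

variable {μ ν : Measure ℝ} {w v : ℝ → ℂ} {K L : Set ℝ}

lemma restrict_eq (h : IsWeightOn μ w K) : μ.restrict K = μ :=
  Measure.restrict_eq_self_of_ae_mem h.ae_mem

lemma mul_continuousOn (h : IsWeightOn μ w K) {g : ℝ → ℂ} (hg : ContinuousOn g K) :
    IsWeightOn μ (fun x => w x * g x) K := by
  refine ⟨h.compact, h.ae_mem, ?_⟩
  have := IntegrableOn.mul_continuousOn (μ := μ) (g := w) (g' := g) (K := K)
    h.integrable.integrableOn hg h.compact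
  rwa [IntegrableOn, h.restrict_eq] at this

lemma continuousOn_kernel {z : ℂ} (hz : z ∉ cSet K) :
    ContinuousOn (fun x : ℝ => (z - (x : ℂ))⁻¹) K :=
  ContinuousOn.inv₀ (by fun_prop) fun _ hx => sub_ofReal_ne_zero hz hx

lemma integrable_kernel (h : IsWeightOn μ w K) {z : ℂ} (hz : z ∉ cSet K) :
    Integrable (fun x : ℝ => w x * (z - (x : ℂ))⁻¹) μ :=
  (h.mul_continuousOn (continuousOn_kernel hz)).integrable

lemma differentiableAt (h : IsWeightOn μ w K) {z : ℂ} (hz : z ∉ cSet K) :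
    DifferentiableAt ℂ (weightedCauchy μ w) z := by
  obtain ⟨δ, hδ, hb⟩ := exists_le_norm_sub_ofReal h.compact hz
  have hK : ∀ y ∈ Metric.ball z δ, y ∉ cSet K := by
    rintro y hy ⟨x, hx, rfl⟩
    have := hb _ hy x hx
    simp at this
    linarith
  refine (hasDerivAt_integral_of_dominated_loc_of_deriv_le
    (F := fun (y : ℂ) (x : ℝ) => w x * (y - (x : ℂ))⁻¹)
    (F' := fun (y : ℂ) (x : ℝ) => w x * (-1 / (y - (x : ℂ)) ^ 2))
    (bound := fun x => ‖w x‖ * (δ ^ 2)⁻¹)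
    (Metric.ball_mem_nhds z hδ) ?_ (h.integrable_kernel hz) ?_ ?_ ?_ ?_).2.differentiableAt
  · filter_upwards [Metric.ball_mem_nhds z hδ] with y hy
    exact (h.integrable_kernel (hK y hy)).aestronglyMeasurable
  · exact (h.mul_continuousOn (ContinuousOn.div (by fun_prop) (by fun_prop)
      fun x hx => pow_ne_zero 2 (sub_ofReal_ne_zero hz hx))).integrable.aestronglyMeasurable
  · filter_upwards [h.ae_mem] with x hx y hy
    rw [norm_mul, norm_div, norm_neg, norm_one, norm_pow, one_div]
    gcongr
    exact hb y hy x hx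
  · exact h.integrable.norm.mul_const _
  · filter_upwards [h.ae_mem] with x hx y hy
    exact (((hasDerivAt_id y).sub_const (x : ℂ)).fun_inv
      (sub_ofReal_ne_zero (hK y hy) hx)).const_mul (w x)

lemma continuousOn (h : IsWeightOn μ w K) : ContinuousOn (weightedCauchy μ w) (cSet K)ᶜ :=
  fun _ hz => (h.differentiableAt hz).continuousAt.continuousWithinAt

lemma continuousOn_real (h : IsWeightOn μ w K) (hd : Disjoint K L) :
    ContinuousOn (fun x : ℝ => weightedCauchy μ w x) L :=
  h.continuousOn.comp (by fun_prop) fun _ hx => notMem_cSet_of_disjoint hd hx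

lemma mul_weightedCauchy (h : IsWeightOn μ w K) (hv : IsWeightOn ν v L) (hd : Disjoint K L) :
    IsWeightOn ν (fun x => v x * weightedCauchy μ w x) L :=
  hv.mul_continuousOn (h.continuousOn_real hd)

lemma tendsto_cocompact (h : IsWeightOn μ w K) :
    Tendsto (weightedCauchy μ w) (cocompact ℂ) (nhds 0) := by
  obtain ⟨R, hR⟩ := h.compact.isBounded.exists_norm_le
  have hlim : Tendsto (fun z : ℂ => (∫ x, ‖w x‖ ∂μ) * (‖z‖ - R)⁻¹) (cocompact ℂ) (nhds 0) := by
    rw [← mul_zero (∫ x, ‖w x‖ ∂μ)]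
    exact ((tendsto_atTop_add_const_right _ (-R)
      (tendsto_norm_cocompact_atTop (E := ℂ))).inv_tendsto_atTop).const_mul _
  refine squeeze_zero_norm' ?_ hlim
  filter_upwards [(tendsto_norm_cocompact_atTop (E := ℂ)).eventually_gt_atTop R] with z hz
  have hzR : 0 < ‖z‖ - R := sub_pos.2 hz
  rw [← integral_mul_const]
  refine norm_integral_le_of_norm_le (h.integrable.norm.mul_const _) ?_
  filter_upwards [h.ae_mem] with x hx
  rw [norm_mul, norm_inv]
  gcongr
  have h1 := norm_sub_norm_le z (x : ℂ)
  have h2 := hR x hx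
  rw [Complex.norm_real] at h1
  linarith

/-- The product of two Cauchy transforms of measures with disjoint supports. -/
lemma weightedCauchy_mul [SFinite μ] [SFinite ν] (h : IsWeightOn μ w K) (hv : IsWeightOn ν v L)
    (hd : Disjoint K L) {z : ℂ} (hz : z ∉ cSet K) (hz' : z ∉ cSet L) :
    weightedCauchy μ w z * weightedCauchy ν v z =
      weightedCauchy μ (fun x => w x * weightedCauchy ν v x) z +
        weightedCauchy ν (fun x => v x * weightedCauchy μ w x) z := by
  have hr : (μ.prod ν).restrict (K ×ˢ L) = μ.prod ν := by
    rw [← Measure.prod_restrict, h.restrict_eq, hv.restrict_eq]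
  have hint : ∀ k : ℝ × ℝ → ℂ, ContinuousOn k (K ×ˢ L) →
      Integrable (fun p : ℝ × ℝ => (w p.1 * v p.2) * k p) (μ.prod ν) := by
    intro k hk
    have := IntegrableOn.mul_continuousOn (μ := μ.prod ν) (K := K ×ˢ L)
      (h.integrable.mul_prod hv.integrable).integrableOn hk (h.compact.prod hv.compact)
    rwa [IntegrableOn, hr] at this
  have hne : ∀ p ∈ K ×ˢ L, ((p.1 : ℂ) - (p.2 : ℂ)) ≠ 0 := fun p hp =>
    sub_ofReal_ne_zero (notMem_cSet_of_disjoint hd.symm hp.1) hp.2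
  have hne' : ∀ p ∈ K ×ˢ L, ((p.2 : ℂ) - (p.1 : ℂ)) ≠ 0 := fun p hp =>
    sub_ofReal_ne_zero (notMem_cSet_of_disjoint hd hp.2) hp.1
  have hG := hint (fun p => (z - (p.1 : ℂ))⁻¹ * ((p.1 : ℂ) - (p.2 : ℂ))⁻¹)
    (ContinuousOn.mul
      (ContinuousOn.inv₀ (by fun_prop) fun p hp => sub_ofReal_ne_zero hz hp.1)
      (ContinuousOn.inv₀ (by fun_prop) hne))
  have hH := hint (fun p => (z - (p.2 : ℂ))⁻¹ * ((p.2 : ℂ) - (p.1 : ℂ))⁻¹)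
    (ContinuousOn.mul
      (ContinuousOn.inv₀ (by fun_prop) fun p hp => sub_ofReal_ne_zero hz' hp.2)
      (ContinuousOn.inv₀ (by fun_prop) hne'))
  have hmem : ∀ᵐ p ∂(μ.prod ν), p ∈ K ×ˢ L := by
    rw [← hr]
    exact ae_restrict_mem (h.compact.prod hv.compact).measurableSet
  have e1 : weightedCauchy μ (fun x => w x * weightedCauchy ν v x) z =
      ∫ p, (w p.1 * v p.2) * ((z - (p.1 : ℂ))⁻¹ * ((p.1 : ℂ) - (p.2 : ℂ))⁻¹) ∂(μ.prod ν) := by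
    rw [integral_prod _ hG]
    refine integral_congr_ae (Eventually.of_forall fun x => ?_)
    simp only [weightedCauchy]
    rw [← integral_const_mul, ← integral_mul_const]
    congr 1
    ext t
    ring
  have e2 : weightedCauchy ν (fun x => v x * weightedCauchy μ w x) z =
      ∫ p, (w p.1 * v p.2) * ((z - (p.2 : ℂ))⁻¹ * ((p.2 : ℂ) - (p.1 : ℂ))⁻¹) ∂(μ.prod ν) := by
    rw [integral_prod_symm _ hH]
    refine integral_congr_ae (Eventually.of_forall fun x => ?_)
    simp only [weightedCauchy]
    rw [← integral_const_mul, ← integral_mul_const]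
    congr 1
    ext t
    ring
  rw [e1, e2, ← integral_add hG hH, weightedCauchy, weightedCauchy, ← integral_prod_mul]
  refine integral_congr_ae ?_
  filter_upwards [hmem] with p hp
  have h1 := sub_ofReal_ne_zero hz hp.1
  have h2 := sub_ofReal_ne_zero hz' hp.2
  have h3 := hne p hp
  have h4 := hne' p hp
  field_simp
  ring

/-- Multiplying the density by an affine function multiplies the Cauchy transform by it, up to
an additive constant. -/
lemma weightedCauchy_affine (h : IsWeightOn μ w K) (m b : ℂ) {z : ℂ} (hz : z ∉ cSet K) :
    weightedCauchy μ (fun x => w x * ((x : ℂ) / m + b)) z =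
      (z / m + b) * weightedCauchy μ w z - (∫ x, w x ∂μ) / m := by
  rw [weightedCauchy, weightedCauchy, ← integral_const_mul, ← integral_div, ← integral_sub
    ((h.integrable_kernel hz).const_mul _) (h.integrable.div_const _)]
  refine integral_congr_ae ?_
  filter_upwards [h.ae_mem] with x hx
  have := sub_ofReal_ne_zero hz hx
  field_simp
  ring

end IsWeightOn

lemma weightedCauchy_congr {μ : Measure ℝ} {w v : ℝ → ℂ} {K : Set ℝ} (hμ : ∀ᵐ x ∂μ, x ∈ K)
    (h : ∀ x ∈ K, w x = v x) : weightedCauchy μ w = weightedCauchy μ v := by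
  ext z
  refine integral_congr_ae ?_
  filter_upwards [hμ] with x hx
  rw [h x hx]

/-- The Cauchy transform of a measure of constant sign on an interval has no zeros outside it. -/
lemma weightedCauchy_ne_zero {μ : Measure ℝ} {g : ℝ → ℝ} {a b : ℝ} (hμ : μ ≠ 0)
    (h : IsWeightOn μ (fun x => (g x : ℂ)) (Icc a b))
    (hg : (∀ x ∈ Icc a b, 0 < g x) ∨ ∀ x ∈ Icc a b, g x < 0) {z : ℂ} (hz : z ∉ cSet (Icc a b)) :
    weightedCauchy μ (fun x => (g x : ℂ)) z ≠ 0 := by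
  obtain ⟨c, hc⟩ : ∃ c : ℂ, ∀ x ∈ Icc a b, 0 < (c * (z - (x : ℂ))⁻¹).re * g x := by
    obtain ⟨c, hc⟩ : ∃ c : ℂ, ∀ x ∈ Icc a b, 0 < (c * (z - (x : ℂ))⁻¹).re := by
      have key : ∃ c : ℂ, ∀ x ∈ Icc a b, 0 < (c * (starRingEnd ℂ) (z - (x : ℂ))).re := by
        by_cases him : z.im = 0
        · have hzr : z = (z.re : ℂ) := Complex.ext rfl (by simpa using him)
          rw [hzr, ofReal_mem_cSet, mem_Icc, not_and_or, not_le, not_le] at hz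
          rcases hz with hz | hz
          · refine ⟨-1, fun x hx => ?_⟩
            simp
            linarith [hx.1]
          · refine ⟨1, fun x hx => ?_⟩
            simp
            linarith [hx.2]
        · refine ⟨Complex.I * z.im, fun x hx => ?_⟩
          simpa using him
      obtain ⟨c, hc⟩ := key
      refine ⟨c, fun x hx => ?_⟩
      have h0 := Complex.normSq_pos.2 (sub_ofReal_ne_zero hz hx)
      rw [Complex.inv_def, ← mul_assoc, Complex.re_mul_ofReal]
      exact mul_pos (hc x hx) (inv_pos.2 h0)
    rcases hg with hg | hg
    · exact ⟨c, fun x hx => mul_pos (hc x hx) (hg x hx)⟩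
    · refine ⟨-c, fun x hx => ?_⟩
      rw [neg_mul, Complex.neg_re, neg_mul, ← mul_neg]
      exact mul_pos (hc x hx) (neg_pos.2 (hg x hx))
  intro h0
  have hi := (h.integrable_kernel hz).const_mul c
  have hre : (fun x : ℝ => (c * ((g x : ℂ) * (z - (x : ℂ))⁻¹)).re) =
      fun x : ℝ => (c * (z - (x : ℂ))⁻¹).re * g x := by
    ext x
    rw [← Complex.re_mul_ofReal]
    congr 1
    ring
  have hire : Integrable (fun x : ℝ => (c * ((g x : ℂ) * (z - (x : ℂ))⁻¹)).re) μ := hi.re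
  have hpos : 0 < ∫ x, (c * ((g x : ℂ) * (z - (x : ℂ))⁻¹)).re ∂μ := by
    rw [integral_pos_iff_support_of_nonneg_ae _ hire]
    · have : Function.support (fun x : ℝ => (c * ((g x : ℂ) * (z - (x : ℂ))⁻¹)).re) ∈ ae μ := by
        filter_upwards [h.ae_mem] with x hx
        rw [hre]
        exact (hc x hx).ne'
      rw [pos_iff_ne_zero]
      intro hs
      exact hμ (Measure.measure_univ_eq_zero.1 (by
        rw [measure_congr (eventuallyEq_univ.2 this).symm, hs]))
    · filter_upwards [h.ae_mem] with x hx
      exact (hc x hx).le.trans_eq (congrFun hre x).symm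
  have hz0 : ∫ x, (c * ((g x : ℂ) * (z - (x : ℂ))⁻¹)).re ∂μ = 0 := by
    have := integral_re hi
    simp only [RCLike.re_eq_complex_re] at this
    rw [this, integral_const_mul]
    have h0' : ∫ x, (g x : ℂ) * (z - (x : ℂ))⁻¹ ∂μ = 0 := h0
    rw [h0']
    simp
  exact hpos.ne' hz0

section Inversion

variable {α β τ : Measure ℝ} {a b t : ℝ → ℂ} {K L : Set ℝ}

lemma exists_weightedCauchy_mul_eq [SFinite τ] [SFinite β]
    (ht : IsWeightOn τ t K) (hb : IsWeightOn β b L) (hd : Disjoint K L) {h : ℂ → ℂ} {m d : ℂ}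
    (hh : ∀ z : ℂ, z ∉ cSet K → h z = z / m + d + weightedCauchy τ t z) :
    ∃ c : ℂ, ∀ z : ℂ, z ∉ cSet K → z ∉ cSet L →
      weightedCauchy τ (fun x => t x * weightedCauchy β b x) z =
        h z * weightedCauchy β b z - weightedCauchy β (fun u => b u * h u) z - c := by
  refine ⟨(∫ x, b x ∂β) / m, fun z hz hz' => ?_⟩
  have e1 := ht.weightedCauchy_mul hb hd hz hz'
  have e2 : weightedCauchy β (fun u => b u * h u) z =
      weightedCauchy β (fun u => b u * ((u : ℂ) / m + d)) z +
        weightedCauchy β (fun u => b u * weightedCauchy τ t u) z := by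
    rw [weightedCauchy_congr hb.ae_mem
      (v := fun u => b u * ((u : ℂ) / m + d) + b u * weightedCauchy τ t u)
      (fun x hx => by rw [hh _ (notMem_cSet_of_disjoint hd hx)]; ring)]
    simp only [weightedCauchy, add_mul]
    exact integral_add ((hb.mul_continuousOn (by fun_prop)).integrable_kernel hz')
      ((ht.mul_weightedCauchy hb hd).integrable_kernel hz')
  rw [hb.weightedCauchy_affine m d hz'] at e2
  rw [e2, hh z hz]
  linear_combination -e1

variable [SFinite α] [SFinite β] [SFinite τ]

/-- The Cauchy transform of `⟨τ, ⟨β, α⟩⟩`, where `τ` is the inverse measure of `α`. -/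
lemma exists_weightedCauchy_inverse_left
    (ha : IsWeightOn α a K) (hb : IsWeightOn β b L) (ht : IsWeightOn τ t K) (hd : Disjoint K L)
    (hA : ∀ z : ℂ, z ∉ cSet K → weightedCauchy α a z ≠ 0) {m d : ℂ}
    (hinv : ∀ z : ℂ, z ∉ cSet K →
      (weightedCauchy α a z)⁻¹ = z / m + d + weightedCauchy τ t z) :
    ∃ c : ℂ, ∀ z : ℂ, z ∉ cSet K →
      weightedCauchy τ (fun x => t x *
          weightedCauchy β (fun u => b u * weightedCauchy α a u) x) z =
        c - weightedCauchy α (fun x => a x * weightedCauchy β b x) z / weightedCauchy α a z := by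
  have hba := ha.mul_weightedCauchy hb hd
  have hab := hb.mul_weightedCauchy ha hd.symm
  obtain ⟨c, hc⟩ := exists_weightedCauchy_mul_eq ht hba hd hinv
  refine ⟨-c, fun z hz => ?_⟩
  refine eq_of_eq_nonreal (hba.mul_weightedCauchy ht hd.symm).continuousOn
    (continuousOn_const.sub (hab.continuousOn.div ha.continuousOn hA)) (fun z him => ?_) hz
  have hzK : z ∉ cSet K := notMem_cSet_of_im_ne_zero him
  have hzL : z ∉ cSet L := notMem_cSet_of_im_ne_zero him
  have hAz := hA z hzK
  have e1 := ha.weightedCauchy_mul hb hd hzK hzL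
  have e2 : weightedCauchy β (fun u => b u * weightedCauchy α a u * (weightedCauchy α a u)⁻¹) =
      weightedCauchy β b :=
    weightedCauchy_congr hb.ae_mem fun x hx =>
      mul_inv_cancel_right₀ (hA _ (notMem_cSet_of_disjoint hd hx)) _
  rw [hc z hzK hzL, e2]
  simp only [Pi.sub_apply, Pi.div_apply]
  field_simp
  linear_combination -e1

/-- The Cauchy transform of `(⟨β, α⟩^ / β̂) τ`, where `τ` is the inverse measure of `⟨α, β⟩`. -/
lemma exists_weightedCauchy_inverse_right
    (ha : IsWeightOn α a K) (hb : IsWeightOn β b L) (ht : IsWeightOn τ t K) (hd : Disjoint K L)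
    (hB : ∀ z : ℂ, z ∉ cSet L → weightedCauchy β b z ≠ 0)
    (hAB : ∀ z : ℂ, z ∉ cSet K →
      weightedCauchy α (fun x => a x * weightedCauchy β b x) z ≠ 0) {m d : ℂ}
    (hinv : ∀ z : ℂ, z ∉ cSet K →
      (weightedCauchy α (fun x => a x * weightedCauchy β b x) z)⁻¹ =
        z / m + d + weightedCauchy τ t z) :
    ∃ c : ℂ, ∀ z : ℂ, z ∉ cSet K →
      weightedCauchy τ (fun x => t x *
          (weightedCauchy β (fun u => b u * weightedCauchy α a u) x / weightedCauchy β b x)) z =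
        c + weightedCauchy α a z /
          weightedCauchy α (fun x => a x * weightedCauchy β b x) z := by
  have hba := ha.mul_weightedCauchy hb hd
  have hab := hb.mul_weightedCauchy ha hd.symm
  set A := weightedCauchy α a with hAdef
  set B := weightedCauchy β b with hBdef
  set AB := weightedCauchy α (fun x => a x * B x) with hABdef
  set BA := weightedCauchy β (fun u => b u * A u) with hBAdef
  have hw : IsWeightOn τ (fun x => t x * (BA x / B x)) K :=
    ht.mul_continuousOn ((hba.continuousOn_real hd.symm).div (hb.continuousOn_real hd.symm)
      fun x hx => hB _ (notMem_cSet_of_disjoint hd.symm hx))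
  set M := weightedCauchy τ (fun x => t x * (BA x / B x)) with hMdef
  set H : ℂ → ℂ := fun z => M z - A z / AB z with hHdef
  have hHdiff : ∀ z, z ∉ cSet K → DifferentiableAt ℂ H z := fun z hz =>
    (hw.differentiableAt hz).sub ((ha.differentiableAt hz).div (hab.differentiableAt hz) (hAB z hz))
  have hHcont : ContinuousOn (fun x : ℝ => H x) L := by
    have : ContinuousOn H (cSet K)ᶜ := fun z hz => (hHdiff z hz).continuousAt.continuousWithinAt
    exact this.comp (by fun_prop) fun _ hx => notMem_cSet_of_disjoint hd hx
  have hbH := hb.mul_continuousOn hHcont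
  obtain ⟨c, hc⟩ := exists_weightedCauchy_mul_eq ht hba hd hinv
  have hrel : ∀ z, z ∉ cSet K → z ∉ cSet L →
      H z * B z = weightedCauchy β (fun u => b u * H u) z - (1 + c) := by
    intro z hz hz'
    have e1 := ha.weightedCauchy_mul hb hd hz hz'
    have e2 := hw.weightedCauchy_mul hb hd hz hz'
    have e3 : weightedCauchy τ (fun x => t x * (BA x / B x) * B x) =
        weightedCauchy τ (fun x => t x * BA x) :=
      weightedCauchy_congr ht.ae_mem fun x hx => by
        rw [mul_assoc, div_mul_cancel₀ _ (hB _ (notMem_cSet_of_disjoint hd.symm hx))]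
    have hS : IsWeightOn β (fun u => b u * A u * (AB u)⁻¹) L :=
      hba.mul_continuousOn ((hab.continuousOn_real hd).inv₀
        fun x hx => hAB _ (notMem_cSet_of_disjoint hd hx))
    have e4 : weightedCauchy β (fun u => b u * H u) z =
        weightedCauchy β (fun u => b u * M u) z -
          weightedCauchy β (fun u => b u * A u * (AB u)⁻¹) z := by
      simp only [weightedCauchy]
      rw [← integral_sub ((hw.mul_weightedCauchy hb hd).integrable_kernel hz')
        (hS.integrable_kernel hz')]
      congr 1
      ext x
      simp only [hHdef]
      ring
    have e5 := hc z hz hz'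
    have hABz := hAB z hz
    rw [← hBdef, ← hMdef, e3, e5] at e2
    rw [← hAdef, ← hBdef, ← hABdef, ← hBAdef] at e1
    rw [e4]
    simp only [hHdef]
    field_simp
    field_simp at e2
    linear_combination e2 - e1
  have hlim : ∃ c', Tendsto H (cocompact ℂ) (nhds c') := by
    have haff : IsWeightOn α (fun x => a x * ((x : ℂ) / m + d)) K :=
      ha.mul_continuousOn (by fun_prop)
    refine ⟨0 - (0 + (∫ x, a x ∂α) / m + 0 * 0), hw.tendsto_cocompact.sub ?_⟩
    refine Tendsto.congr' ?_ (((haff.tendsto_cocompact.add_const ((∫ x, a x ∂α) / m))).add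
      (ha.tendsto_cocompact.mul ht.tendsto_cocompact))
    filter_upwards [(isCompact_cSet ha.compact).compl_mem_cocompact] with z hz
    rw [ha.weightedCauchy_affine m d hz, div_eq_mul_inv (A z), hinv z hz]
    ring
  obtain ⟨c', hc'⟩ := hlim
  classical
  set F : ℂ → ℂ := fun z => (weightedCauchy β (fun u => b u * H u) z - (1 + c)) / B z with hFdef
  set E : ℂ → ℂ := fun z => if z ∈ cSet K then F z else H z with hEdef
  have hEH : ∀ z, z ∉ cSet K → E z = H z := fun z hz => if_neg hz
  have hEF : ∀ z, z ∉ cSet L → E z = F z := by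
    intro z hz
    by_cases hzK : z ∈ cSet K
    · exact if_pos hzK
    · rw [hEH z hzK]
      exact (eq_div_iff (hB z hz)).2 (hrel z hzK hz)
  have hE : Differentiable ℂ E := by
    intro z
    by_cases hz : z ∈ cSet K
    · have hzL : z ∉ cSet L := by
        obtain ⟨x, hx, rfl⟩ := hz
        exact notMem_cSet_of_disjoint hd.symm hx
      have hF : DifferentiableAt ℂ F z :=
        ((hbH.differentiableAt hzL).sub_const _).div (hb.differentiableAt hzL) (hB z hzL)
      refine hF.congr_of_eventuallyEq ?_
      filter_upwards [(isCompact_cSet hb.compact).isClosed.isOpen_compl.mem_nhds hzL] with y hy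
      exact hEF y hy
    · refine (hHdiff z hz).congr_of_eventuallyEq ?_
      filter_upwards [(isCompact_cSet ha.compact).isClosed.isOpen_compl.mem_nhds hz] with y hy
      exact hEH y hy
  have hElim : Tendsto E (cocompact ℂ) (nhds c') := by
    refine hc'.congr' ?_
    filter_upwards [(isCompact_cSet ha.compact).compl_mem_cocompact] with z hz
    exact (hEH z hz).symm
  have hconst := hE.eq_const_of_tendsto_cocompact hElim
  refine ⟨c', fun z hz => ?_⟩
  have : H z = c' := by rw [← hEH z hz, hconst]; rfl
  rw [← this]
  simp only [hHdef]
  ring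

end Inversion

lemma weightedCauchy_const_add_mul {μ : Measure ℝ} {w g k : ℝ → ℂ} {K : Set ℝ}
    (hw : IsWeightOn μ w K) (hk : IsWeightOn μ k K) (c d : ℂ)
    (h : ∀ x ∈ K, g x = c * w x + d * k x) {z : ℂ} (hz : z ∉ cSet K) :
    weightedCauchy μ g z = c * weightedCauchy μ w z + d * weightedCauchy μ k z := by
  rw [weightedCauchy_congr hw.ae_mem h]
  simp only [weightedCauchy]
  rw [← integral_const_mul, ← integral_const_mul, ← integral_add
    ((hw.integrable_kernel hz).const_mul c) ((hk.integrable_kernel hz).const_mul d)]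
  congr 1
  ext x
  ring

lemma weightedCauchy_inverse_identity {α β γ τ ρ : Measure ℝ} [SFinite α] [SFinite β] [SFinite γ]
    [SFinite τ] [SFinite ρ] {a b g t r : ℝ → ℂ} {K L G : Set ℝ}
    (ha : IsWeightOn α a K) (hb : IsWeightOn β b L) (hg : IsWeightOn γ g G)
    (ht : IsWeightOn τ t K) (hr : IsWeightOn ρ r K) (hKL : Disjoint K L) (hKG : Disjoint K G)
    (hA : ∀ z : ℂ, z ∉ cSet K → weightedCauchy α a z ≠ 0)
    (hB : ∀ z : ℂ, z ∉ cSet L → weightedCauchy β b z ≠ 0)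
    (hAB : ∀ z : ℂ, z ∉ cSet K →
      weightedCauchy α (fun x => a x * weightedCauchy β b x) z ≠ 0) {m d m' d' : ℂ}
    (hτ : ∀ z : ℂ, z ∉ cSet K →
      (weightedCauchy α a z)⁻¹ = z / m + d + weightedCauchy τ t z)
    (hρ : ∀ z : ℂ, z ∉ cSet K →
      (weightedCauchy α (fun x => a x * weightedCauchy β b x) z)⁻¹ =
        z / m' + d' + weightedCauchy ρ r z) {z : ℂ} (hz : z ∉ cSet K) :
    weightedCauchy α a z / weightedCauchy α (fun x => a x * weightedCauchy β b x) z *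
        weightedCauchy τ (fun x => t x *
          weightedCauchy β (fun u => b u * weightedCauchy α a u) x *
          weightedCauchy γ (fun u => g u * weightedCauchy α a u) x) z =
      weightedCauchy ρ (fun x => r x *
          (weightedCauchy β (fun u => b u * weightedCauchy α a u) x / weightedCauchy β b x) *
          weightedCauchy γ (fun u => g u *
            weightedCauchy α (fun x => a x * weightedCauchy β b x) u) x) z := by
  obtain ⟨c, hc⟩ := exists_weightedCauchy_inverse_left ha hb ht hKL hA hτ
  obtain ⟨c', hc'⟩ := exists_weightedCauchy_inverse_right ha hb hr hKL hB hAB hρ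
  have hba := ha.mul_weightedCauchy hb hKL
  have hab := hb.mul_weightedCauchy ha hKL.symm
  have hP := hba.mul_weightedCauchy ht hKL.symm
  set A := weightedCauchy α a with hAdef
  set B := weightedCauchy β b with hBdef
  set AB := weightedCauchy α (fun x => a x * B x) with hABdef
  set BA := weightedCauchy β (fun u => b u * A u) with hBAdef
  have hM : IsWeightOn ρ (fun x => r x * (BA x / B x)) K :=
    hr.mul_continuousOn ((hba.continuousOn_real hKL.symm).div (hb.continuousOn_real hKL.symm)
      fun x hx => hB _ (notMem_cSet_of_disjoint hKL.symm hx))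
  set P := weightedCauchy τ (fun x => t x * BA x) with hPdef
  set M := weightedCauchy ρ (fun x => r x * (BA x / B x)) with hMdef
  have hga : IsWeightOn γ (fun x => g x * A x) G := ha.mul_weightedCauchy hg hKG
  have hgab : IsWeightOn γ (fun x => g x * AB x) G := hab.mul_weightedCauchy hg hKG
  refine eq_of_eq_nonreal ((ha.continuousOn.div hab.continuousOn hAB).mul
    (hga.mul_weightedCauchy hP hKG.symm).continuousOn)
    (hgab.mul_weightedCauchy hM hKG.symm).continuousOn (fun z him => ?_) hz
  have hzK : z ∉ cSet K := notMem_cSet_of_im_ne_zero him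
  have hzG : z ∉ cSet G := notMem_cSet_of_im_ne_zero him
  have e1 := hP.weightedCauchy_mul hga hKG hzK hzG
  have e2 := hM.weightedCauchy_mul hgab hKG hzK hzG
  have e3 : weightedCauchy γ (fun x => g x * A x * P x) z =
      c * weightedCauchy γ (fun x => g x * A x) z +
        (-1) * weightedCauchy γ (fun x => g x * AB x) z := by
    refine weightedCauchy_const_add_mul hga hgab c (-1) (fun x hx => ?_) hzG
    have hx' := notMem_cSet_of_disjoint hKG hx
    have := hA _ hx'
    rw [hc _ hx']
    field_simp
    ring
  have e4 : weightedCauchy γ (fun x => g x * AB x * M x) z =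
      c' * weightedCauchy γ (fun x => g x * AB x) z +
        1 * weightedCauchy γ (fun x => g x * A x) z := by
    refine weightedCauchy_const_add_mul hgab hga c' 1 (fun x hx => ?_) hzG
    have hx' := notMem_cSet_of_disjoint hKG hx
    have := hAB _ hx'
    rw [hc' _ hx']
    field_simp
  have hAz := hA z hzK
  have hABz := hAB z hzK
  rw [← hPdef, e3, hc z hzK, ← sub_eq_iff_eq_add] at e1
  rw [← hMdef, e4, hc' z hzK, ← sub_eq_iff_eq_add] at e2
  simp only [Pi.mul_apply, Pi.div_apply]
  rw [← e1, ← e2, ← hAdef, ← hABdef]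
  field_simp
  ring

namespace SignedM

/-- Integration against the signed measure `s` is integration against `μ` with density `w`. -/
structure IsRepresentedBy (s : SignedM) (μ : Measure ℝ) (w : ℝ → ℂ) : Prop where
  sfinite_pos : SFinite s.pos
  sfinite_neg : SFinite s.neg
  pos_ac : s.pos ≪ μ
  neg_ac : s.neg ≪ μ
  integral : ∀ F : ℝ → ℂ, Integrable (fun x => w x * F x) μ →
    Integrable F s.pos ∧ Integrable F s.neg ∧ s.cintegral F = ∫ x, w x * F x ∂μ

lemma ofReal_cauchyR (s : SignedM) (x : ℝ) : ((s.cauchyR x : ℝ) : ℂ) = s.cauchy x := by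
  simp only [cauchyR, rintegral, cauchy, cintegral, Complex.ofReal_sub]
  rw [← integral_complex_ofReal, ← integral_complex_ofReal]
  simp

lemma integrable_withDensity_ofReal {μ : Measure ℝ} {g : ℝ → ℝ} {F : ℝ → ℂ}
    (hg : AEMeasurable g μ) (h : Integrable (fun x => (g x : ℂ) * F x) μ) :
    Integrable F (μ.withDensity fun x => ENNReal.ofReal (g x)) ∧
      ∫ x, F x ∂(μ.withDensity fun x => ENNReal.ofReal (g x)) =
        ∫ x, ((max (g x) 0 : ℝ) : ℂ) * F x ∂μ ∧
      Integrable (fun x => ((max (g x) 0 : ℝ) : ℂ) * F x) μ := by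
  have hlt : ∀ᵐ x ∂μ, ENNReal.ofReal (g x) < ⊤ := Eventually.of_forall fun _ => ENNReal.ofReal_lt_top
  have hint : Integrable (fun x => ((max (g x) 0 : ℝ) : ℂ) * F x) μ := by
    have := h.indicator₀ (s := {x | 0 < g x}) (nullMeasurableSet_lt aemeasurable_const hg)
    refine this.congr (Eventually.of_forall fun x => ?_)
    by_cases hx : 0 < g x
    · simp [indicator, hx, max_eq_left hx.le]
    · simp [indicator, hx, max_eq_right (not_lt.1 hx)]
  have heq : (fun x => (ENNReal.ofReal (g x)).toReal • F x) =
      fun x => ((max (g x) 0 : ℝ) : ℂ) * F x := by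
    ext x
    rw [ENNReal.toReal_ofReal', Complex.real_smul]
  refine ⟨?_, ?_, hint⟩
  · rw [integrable_withDensity_iff_integrable_smul₀' hg.ennreal_ofReal hlt, heq]
    exact hint
  · rw [integral_withDensity_eq_integral_toReal_smul₀ hg.ennreal_ofReal hlt, heq]

namespace IsRepresentedBy

variable {s : SignedM} {μ : Measure ℝ} {w : ℝ → ℂ}

lemma measurable_cauchyR (h : s.IsRepresentedBy μ w) : Measurable s.cauchyR := by
  have := h.sfinite_pos
  have := h.sfinite_neg
  have hk : StronglyMeasurable fun p : ℝ × ℝ => (p.1 - p.2)⁻¹ :=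
    (measurable_fst.sub measurable_snd).inv.stronglyMeasurable
  exact (hk.integral_prod_right' (ν := s.pos)).measurable.sub
    (hk.integral_prod_right' (ν := s.neg)).measurable

lemma withDensityR (h : s.IsRepresentedBy μ w) {g : ℝ → ℝ} (hg : AEMeasurable g μ) :
    (s.withDensityR g).IsRepresentedBy μ (fun x => w x * (g x : ℂ)) := by
  have := h.sfinite_pos
  have := h.sfinite_neg
  have ac : ∀ (k : ℝ → ENNReal) (ν : Measure ℝ), ν ≪ μ → ν.withDensity k ≪ μ :=
    fun k ν hν => (withDensity_absolutelyContinuous ν k).trans hν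
  refine ⟨?_, ?_, ?_, ?_, fun F hF => ?_⟩
  · simp only [SignedM.withDensityR]
    infer_instance
  · simp only [SignedM.withDensityR]
    infer_instance
  · exact (ac _ _ h.pos_ac).add_left (ac _ _ h.neg_ac)
  · exact (ac _ _ h.pos_ac).add_left (ac _ _ h.neg_ac)
  · have hgF : Integrable (fun x => w x * ((g x : ℂ) * F x)) μ := by
      simpa only [mul_assoc] using hF
    obtain ⟨hp, hn, hi⟩ := h.integral _ hgF
    have hgp := hg.mono_ac h.pos_ac
    have hgn := hg.mono_ac h.neg_ac
    have hnegint : ∀ ν : Measure ℝ, Integrable (fun x => (g x : ℂ) * F x) ν →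
        Integrable (fun x => ((-g x : ℝ) : ℂ) * F x) ν := fun ν hν => by
      simp only [Complex.ofReal_neg, neg_mul]
      exact hν.neg
    obtain ⟨p1, p2, p3⟩ := integrable_withDensity_ofReal hgp hp
    obtain ⟨q1, q2, q3⟩ := integrable_withDensity_ofReal hgn hn
    obtain ⟨p1', p2', p3'⟩ := integrable_withDensity_ofReal (g := fun x => -g x) hgp.neg (hnegint _ hp)
    obtain ⟨q1', q2', q3'⟩ := integrable_withDensity_ofReal (g := fun x => -g x) hgn.neg (hnegint _ hn)
    have hsub : ∀ ν : Measure ℝ,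
        Integrable (fun x => ((max (g x) 0 : ℝ) : ℂ) * F x) ν →
        Integrable (fun x => ((max (-g x) 0 : ℝ) : ℂ) * F x) ν →
        ∫ x, ((max (g x) 0 : ℝ) : ℂ) * F x ∂ν - ∫ x, ((max (-g x) 0 : ℝ) : ℂ) * F x ∂ν =
          ∫ x, (g x : ℂ) * F x ∂ν := fun ν h1 h2 => by
      rw [← integral_sub h1 h2]
      congr 1
      ext x
      rw [← sub_mul, ← Complex.ofReal_sub]
      congr 2
      rcases le_total 0 (g x) with hx | hx
      · rw [max_eq_left hx, max_eq_right (neg_nonpos.2 hx), sub_zero]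
      · rw [max_eq_right hx, max_eq_left (neg_nonneg.2 hx), zero_sub, neg_neg]
    refine ⟨integrable_add_measure.2 ⟨p1, q1'⟩, integrable_add_measure.2 ⟨p1', q1⟩, ?_⟩
    have e1 := hsub _ p3 p3'
    have e2 := hsub _ q3 q3'
    rw [cintegral] at hi ⊢
    simp only [SignedM.withDensityR, mul_assoc]
    rw [← hi, integral_add_measure p1 q1', integral_add_measure p1' q1,
      p2, q2, p2', q2', ← e1, ← e2]
    ring

lemma congr (h : s.IsRepresentedBy μ w) {w' : ℝ → ℂ} (hw : w =ᵐ[μ] w') :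
    s.IsRepresentedBy μ w' := by
  refine ⟨h.sfinite_pos, h.sfinite_neg, h.pos_ac, h.neg_ac, fun F hF => ?_⟩
  have hwF : (fun x => w x * F x) =ᵐ[μ] fun x => w' x * F x := by
    filter_upwards [hw] with x hx
    rw [hx]
  rw [← integral_congr_ae hwF]
  exact h.integral F (hF.congr hwF.symm)

lemma cauchy_eq (h : s.IsRepresentedBy μ w) {K : Set ℝ} (hw : IsWeightOn μ w K) {z : ℂ}
    (hz : z ∉ cSet K) : s.cauchy z = weightedCauchy μ w z :=
  (h.integral _ (hw.integrable_kernel hz)).2.2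

lemma ofReal_cauchyR_eq (h : s.IsRepresentedBy μ w) {K L : Set ℝ} (hw : IsWeightOn μ w K)
    (hd : Disjoint K L) {x : ℝ} (hx : x ∈ L) :
    ((s.cauchyR x : ℝ) : ℂ) = weightedCauchy μ w x := by
  rw [ofReal_cauchyR, h.cauchy_eq hw (notMem_cSet_of_disjoint hd hx)]

lemma nik (h : s.IsRepresentedBy μ w) {K L : Set ℝ} (hμ : ∀ᵐ x ∂μ, x ∈ K)
    {r : SignedM} {ν : Measure ℝ} {v : ℝ → ℂ} (hr : r.IsRepresentedBy ν v)
    (hv : IsWeightOn ν v L) (hd : Disjoint L K) :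
    (s.nik r).IsRepresentedBy μ (fun x => w x * weightedCauchy ν v x) := by
  refine (h.withDensityR hr.measurable_cauchyR.aemeasurable).congr ?_
  filter_upwards [hμ] with x hx
  rw [hr.ofReal_cauchyR_eq hv hd hx]

end IsRepresentedBy

lemma msupport_eq_support (μ : Measure ℝ) : msupport μ = μ.support := by
  rw [Measure.support_eq_forall_isOpen]
  ext x
  simp only [msupport, mem_ofPred_eq, pos_iff_ne_zero]
  exact ⟨fun h U hx hU => h U hU hx, fun h U hU hx => h U hx hU⟩

end SignedM

open SignedM in
lemma IsM.exists_isRepresentedBy {s : SignedM} {Δ : Set ℝ} (h : IsM s Δ) :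
    ∃ (μ : Measure ℝ) (ε : ℝ), (μ = s.pos ∨ μ = s.neg) ∧ (0 < ε ∨ ε < 0) ∧ IsFiniteMeasure μ ∧
      μ ≠ 0 ∧ (∀ᵐ x ∂μ, x ∈ Δ) ∧ s.IsRepresentedBy μ (fun _ => (ε : ℂ)) := by
  have hΔ : s.supp ⊆ Δ := fun x hx => by
    rw [h.hullEq]
    exact ⟨csInf_le h.compactSupp.bddBelow hx, le_csSup h.compactSupp.bddAbove hx⟩
  have hfp := h.posFinite
  have hfn := h.negFinite
  have hne := h.infiniteSupp.nonempty
  have hmem : ∀ μ : Measure ℝ, msupport μ ⊆ s.supp → ∀ᵐ x ∂μ, x ∈ Δ := fun μ hμ => by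
    rw [msupport_eq_support] at hμ
    filter_upwards [μ.support_mem_ae] with x hx using hΔ (hμ hx)
  have hzero : msupport (0 : Measure ℝ) = ∅ := by
    rw [msupport_eq_support, Measure.support_zero]
  rcases h.constSign with h0 | h0
  · refine ⟨s.neg, -1, Or.inr rfl, Or.inr (by norm_num), hfn, fun h1 => ?_,
      hmem _ subset_union_right, inferInstance, inferInstance, ?_, Measure.AbsolutelyContinuous.rfl,
      fun F hF => ?_⟩
    · simp [supp, h0, h1, hzero] at hne
    · rw [h0]
      exact Measure.AbsolutelyContinuous.zero _
    · have hF' : Integrable F s.neg := by simpa using hF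
      refine ⟨by rw [h0]; exact integrable_zero_measure, hF', ?_⟩
      simp [cintegral, h0, integral_neg]
  · refine ⟨s.pos, 1, Or.inl rfl, Or.inl one_pos, hfp, fun h1 => ?_,
      hmem _ subset_union_left, inferInstance, inferInstance, Measure.AbsolutelyContinuous.rfl, ?_,
      fun F hF => ?_⟩
    · simp [supp, h0, h1, hzero] at hne
    · rw [h0]
      exact Measure.AbsolutelyContinuous.zero _
    · have hF' : Integrable F s.pos := by simpa using hF
      refine ⟨hF', by rw [h0]; exact integrable_zero_measure, ?_⟩
      simp [cintegral, h0]

lemma pos_or_neg_of_continuousOn_Icc {g : ℝ → ℝ} {a b : ℝ} (hg : ContinuousOn g (Icc a b))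
    (h0 : ∀ x ∈ Icc a b, g x ≠ 0) : (∀ x ∈ Icc a b, 0 < g x) ∨ ∀ x ∈ Icc a b, g x < 0 := by
  by_contra! hcon
  obtain ⟨⟨x, hx, hxg⟩, ⟨y, hy, hyg⟩⟩ := hcon
  obtain ⟨u, hu, hu0⟩ := isPreconnected_Icc.intermediate_value hx hy hg ⟨hxg, hyg⟩
  exact h0 u hu hu0

/-- Formula (2.6) ("inversa2*"): for every `f ∈ L¹(σ_γ)` and `z ∈ ℂ ∖ Δ_α`,
`(σ̂_α/⟨σ_α,σ_β⟩^)(z) · ⟨⟨τ_{α,α}, σ_β, σ_α⟩, f σ_γ, σ_α⟩^(z)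
  = ⟨(⟨σ_β,σ_α⟩^/σ̂_β) τ_{α,β}, f σ_γ, σ_α, σ_β⟩^(z)`. -/
theorem stmt18
    (Δa Δb Δg : Set ℝ) (σa σb σg : SignedM)
    (ha : IsM σa Δa) (hb : IsM σb Δb) (hg : IsM σg Δg)
    (hga : Δg ∩ Δa = ∅) (hba : Δb ∩ Δa = ∅)
    (τaa : SignedM) (hτaaM : IsM τaa Δa) (hτaa : IsInverse σa τaa Δa)
    (τab : SignedM) (hτabM : IsM τab Δa) (hτab : IsInverse (σa.nik σb) τab Δa)
    (f : ℝ → ℝ)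
    (hf1 : MeasureTheory.Integrable f σg.pos)
    (hf2 : MeasureTheory.Integrable f σg.neg) :
    ∀ z : ℂ, z ∉ cSet Δa →
      σa.cauchy z / (σa.nik σb).cauchy z *
          ((τaa.nik (σb.nik σa)).nik ((σg.withDensityR f).nik σa)).cauchy z =
        ((τab.withDensityR fun x => (σb.nik σa).cauchyR x / σb.cauchyR x).nik
            ((σg.withDensityR f).nik (σa.nik σb))).cauchy z := by
  intro z hz
  have hKL : Disjoint Δa Δb := (disjoint_iff_inter_eq_empty.2 hba).symm
  have hKG : Disjoint Δa Δg := (disjoint_iff_inter_eq_empty.2 hga).symm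
  have cpt : ∀ {s : SignedM} {Δ : Set ℝ}, IsM s Δ → IsCompact Δ := fun h => by
    rw [h.hullEq]
    exact isCompact_Icc
  obtain ⟨α, εa, -, hεa, hαf, hα0, hαK, hra⟩ := ha.exists_isRepresentedBy
  obtain ⟨β, εb, -, hεb, hβf, hβ0, hβL, hrb⟩ := hb.exists_isRepresentedBy
  obtain ⟨γ, εg, hγ, -, hγf, -, hγG, hrg⟩ := hg.exists_isRepresentedBy
  obtain ⟨τ, εt, -, -, hτf, -, hτK, hrt⟩ := hτaaM.exists_isRepresentedBy
  obtain ⟨ρ, εr, -, -, hρf, -, hρK, hrr⟩ := hτabM.exists_isRepresentedBy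
  have hfγ : Integrable f γ := by rcases hγ with rfl | rfl <;> assumption
  have wa : IsWeightOn α (fun _ => (εa : ℂ)) Δa := ⟨cpt ha, hαK, integrable_const _⟩
  have wb : IsWeightOn β (fun _ => (εb : ℂ)) Δb := ⟨cpt hb, hβL, integrable_const _⟩
  have wt : IsWeightOn τ (fun _ => (εt : ℂ)) Δa := ⟨cpt ha, hτK, integrable_const _⟩
  have wr : IsWeightOn ρ (fun _ => (εr : ℂ)) Δa := ⟨cpt ha, hρK, integrable_const _⟩
  have wg : IsWeightOn γ (fun x => (εg : ℂ) * (f x : ℂ)) Δg :=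
    ⟨cpt hg, hγG, hfγ.ofReal.const_mul _⟩
  have hrf := hrg.withDensityR hfγ.aemeasurable
  have hsgn : ∀ {ε : ℝ} (Δ : Set ℝ), (0 < ε ∨ ε < 0) →
      (∀ x ∈ Δ, 0 < ε) ∨ ∀ x ∈ Δ, ε < 0 := fun _ h => h.imp (fun h _ _ => h) fun h _ _ => h
  have hA : ∀ z, z ∉ cSet Δa → weightedCauchy α (fun _ => (εa : ℂ)) z ≠ 0 := by
    rw [ha.hullEq] at wa ⊢
    exact fun z hz => weightedCauchy_ne_zero hα0 wa (hsgn _ hεa) hz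
  have hB : ∀ z, z ∉ cSet Δb → weightedCauchy β (fun _ => (εb : ℂ)) z ≠ 0 := by
    rw [hb.hullEq] at wb ⊢
    exact fun z hz => weightedCauchy_ne_zero hβ0 wb (hsgn _ hεb) hz
  have hBK : ∀ x ∈ Δa, ((σb.cauchyR x : ℝ) : ℂ) = weightedCauchy β (fun _ => (εb : ℂ)) x :=
    fun x hx => hrb.ofReal_cauchyR_eq wb hKL.symm hx
  have hBcont : ContinuousOn σb.cauchyR Δa := by
    refine (Complex.continuous_re.comp_continuousOn (wb.continuousOn_real hKL.symm)).congr ?_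
    intro x hx
    simp [← hBK x hx]
  have hBne : ∀ x ∈ Δa, σb.cauchyR x ≠ 0 := fun x hx h0 =>
    hB x (notMem_cSet_of_disjoint hKL.symm hx) (by rw [← hBK x hx, h0, Complex.ofReal_zero])
  have hBsgn := pos_or_neg_of_continuousOn_Icc (ha.hullEq ▸ hBcont) (ha.hullEq ▸ hBne)
  have wab := wb.mul_weightedCauchy wa hKL.symm
  have wba := wa.mul_weightedCauchy wb hKL
  have wga := wa.mul_weightedCauchy wg hKG
  have wgab := wab.mul_weightedCauchy wg hKG
  have hAB : ∀ z, z ∉ cSet Δa → weightedCauchy α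
      (fun x => (εa : ℂ) * weightedCauchy β (fun _ => (εb : ℂ)) x) z ≠ 0 := by
    intro z hz
    rw [weightedCauchy_congr hαK (v := fun x => ((εa * σb.cauchyR x : ℝ) : ℂ))
      (fun x hx => by rw [Complex.ofReal_mul, hBK x hx])]
    have wab' : IsWeightOn α (fun x => ((εa * σb.cauchyR x : ℝ) : ℂ)) Δa := by
      simp only [Complex.ofReal_mul]
      exact wa.mul_continuousOn (Complex.continuous_ofReal.comp_continuousOn hBcont)
    rw [ha.hullEq] at wab' hz
    refine weightedCauchy_ne_zero hα0 wab' ?_ hz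
    rcases hεa with h | h <;> rcases hBsgn with h' | h'
    · exact Or.inl fun x hx => mul_pos h (h' x hx)
    · exact Or.inr fun x hx => mul_neg_of_pos_of_neg h (h' x hx)
    · exact Or.inr fun x hx => mul_neg_of_neg_of_pos h (h' x hx)
    · exact Or.inl fun x hx => mul_pos_of_neg_of_neg h (h' x hx)
  have rab := hra.nik hαK hrb wb hKL.symm
  have rba := hrb.nik hβL hra wa hKL
  have rga := hrf.nik hγG hra wa hKG
  have rgab := hrf.nik hγG rab wab hKG
  have rl := (hrt.nik hτK rba wba hKL.symm).nik hτK rga wga hKG.symm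
  have wl := wga.mul_weightedCauchy (wba.mul_weightedCauchy wt hKL.symm) hKG.symm
  have rm := (hrr.withDensityR
    (rba.measurable_cauchyR.div hrb.measurable_cauchyR).aemeasurable).congr
    (w' := fun x => (εr : ℂ) * (weightedCauchy β
      (fun u => (εb : ℂ) * weightedCauchy α (fun _ => (εa : ℂ)) u) x /
        weightedCauchy β (fun _ => (εb : ℂ)) x)) (by
      filter_upwards [hρK] with x hx
      rw [Pi.div_apply, Complex.ofReal_div, hBK x hx, rba.ofReal_cauchyR_eq wba hKL.symm hx])
  have wm := wr.mul_continuousOn ((wba.continuousOn_real hKL.symm).div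
    (wb.continuousOn_real hKL.symm) fun x hx => hB _ (notMem_cSet_of_disjoint hKL.symm hx))
  have rr := rm.nik hρK rgab wgab hKG.symm
  have wrr := wgab.mul_weightedCauchy wm hKG.symm
  obtain ⟨d, hd⟩ := hτaa
  obtain ⟨d', hd'⟩ := hτab
  have key := weightedCauchy_inverse_identity wa wb wg wt wr hKL hKG hA hB hAB
    (fun z hz => by rw [← hra.cauchy_eq wa hz, hd z hz, hrt.cauchy_eq wt hz])
    (fun z hz => by rw [← rab.cauchy_eq wab hz, hd' z hz, hrr.cauchy_eq wr hz]) hz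
  rw [hra.cauchy_eq wa hz, rab.cauchy_eq wab hz, rl.cauchy_eq wl hz, key]
  exact (rr.cauchy_eq wrr hz).symm
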